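/- Let G be a finite simple graph and let v be a vertex of degree exactly 4 lying on exactly one pendent triangle v t1 t2 (t1, t2 distinct degree-2 vertices with t1~t2 and both adjacent to v), with remaining neighbors v1 and v2, where v1 has degree exactly 2 in G and does not lie on a pendent triangle (its second neighbor is not adjacent to v1's neighbors so as to form a pendent triangle; i.e., v1 is a 2-vertex whose two neighbors are not adjacent). If the graph G − {t1, t2} has an FII-partition, then G has an FII-partition. -/

import Mathlib

open scoped Classical

/-- `S` is a *2-independent set* of `G`: any two distinct vertices of `S` are at
distance at least 3 in `G`, i.e. they are non-adjacent and have no common neighbor. -/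
def TwoIndepSet {W : Type*} (G : SimpleGraph W) (S : Set W) : Prop :=
  ∀ u ∈ S, ∀ v ∈ S, u ≠ v → ¬G.Adj u v ∧ ∀ w, ¬(G.Adj u w ∧ G.Adj w v)

/-- `F ⊔ A ⊔ B` is an *FII-partition* of `G`: the three sets partition the vertex set,
the subgraph induced on `F` is a forest (acyclic), and `A`, `B` are 2-independent sets. -/
def IsFIIPartition {W : Type*} (G : SimpleGraph W) (F A B : Set W) : Prop :=
  (∀ v, v ∈ F ∨ v ∈ A ∨ v ∈ B) ∧
    Disjoint F A ∧ Disjoint F B ∧ Disjoint A B ∧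
    (G.induce F).IsAcyclic ∧ TwoIndepSet G A ∧ TwoIndepSet G B

/-- `G` admits some FII-partition. -/
def HasFIIPartition {W : Type*} (G : SimpleGraph W) : Prop :=
  ∃ F A B, IsFIIPartition G F A B

namespace SimpleGraph

variable {V : Type*} {G : SimpleGraph V}

/-- The neighbors of `v` are exactly the elements of any finset of neighbors of size `deg v`. -/
lemma adj_iff_mem_of_card_eq_degree {v : V} [Fintype (G.neighborSet v)] {s : Finset V}
    (hs : ∀ w ∈ s, G.Adj v w) (hcard : G.degree v = s.card) (w : V) : G.Adj v w ↔ w ∈ s := by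
  have h : s = G.neighborFinset v :=
    Finset.eq_of_subset_of_card_le (fun w hw => (G.mem_neighborFinset v w).2 (hs w hw))
      (by rw [card_neighborFinset_eq_degree, hcard])
  rw [h, mem_neighborFinset]

/-- Acyclicity of an induced subgraph in terms of cycles of the ambient graph. -/
lemma isAcyclic_induce_iff {s : Set V} :
    (G.induce s).IsAcyclic ↔
      ∀ (x : V) (c : G.Walk x x), c.IsCycle → ∃ y ∈ c.support, y ∉ s := by
  constructor
  · intro h x c hc
    by_contra! hcs
    refine h (c.induce s hcs) ?_
    rw [← Walk.isCycle_map_iff_of_injective (f := (Embedding.induce s).toHom)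
      (Embedding.induce (G := G) s).injective, Walk.map_induce]
    exact hc
  · intro h x c hc
    obtain ⟨y, hy, hys⟩ := h _ _ (hc.map (f := (Embedding.induce s).toHom)
      (Embedding.induce (G := G) s).injective)
    rw [Walk.support_map, List.mem_map] at hy
    obtain ⟨z, -, rfl⟩ := hy
    exact hys z.2

/-- Every vertex of a cycle has two distinct neighbors on the cycle. -/
lemma Walk.IsCycle.exists_two_adj {x y : V} {c : G.Walk x x} (hc : c.IsCycle)
    (hy : y ∈ c.support) :
    ∃ a ∈ c.support, ∃ b ∈ c.support, a ≠ b ∧ G.Adj y a ∧ G.Adj y b := by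
  have hr := hc.rotate hy
  have hmem : ∀ a, a ∈ (c.rotate y hy).support → a ∈ c.support := fun a ha =>
    (Walk.mem_support_rotate_iff c y hy).1 ha
  exact ⟨_, hmem _ (Walk.getVert_mem_support _ 1), _,
    hmem _ (Walk.getVert_mem_support _ _), hr.snd_ne_penultimate,
    Walk.adj_snd hr.not_nil, (Walk.adj_penultimate hr.not_nil).symm⟩

/-- Adding a vertex with at most one neighbor in an induced forest yields an induced forest. -/
lemma IsAcyclic.induce_insert {s : Set V} (h : (G.induce s).IsAcyclic) {x : V}
    (hx : ∀ a ∈ s, ∀ b ∈ s, G.Adj x a → G.Adj x b → a = b) :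
    (G.induce (insert x s)).IsAcyclic := by
  rw [isAcyclic_induce_iff] at h ⊢
  intro y c hc
  by_contra! hcs
  by_cases hxc : x ∈ c.support
  · obtain ⟨a, ha, b, hb, hab, hxa, hxb⟩ := hc.exists_two_adj hxc
    exact hab (hx a ((hcs a ha).resolve_left hxa.ne') b ((hcs b hb).resolve_left hxb.ne') hxa hxb)
  · obtain ⟨z, hz, hzs⟩ := h y c hc
    exact hzs ((hcs z hz).resolve_left fun e => hxc (e ▸ hz))

lemma IsAcyclic.induce_mono {s t : Set V} (h : (G.induce t).IsAcyclic) (hst : s ⊆ t) :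
    (G.induce s).IsAcyclic := by
  rw [isAcyclic_induce_iff] at h ⊢
  intro x c hc
  obtain ⟨y, hy, hyt⟩ := h x c hc
  exact ⟨y, hy, fun hys => hyt (hst hys)⟩

lemma IsAcyclic.induce_image_val {s : Set V} {F : Set s} (h : ((G.induce s).induce F).IsAcyclic) :
    (G.induce (Subtype.val '' F)).IsAcyclic := by
  have hs (x : (Subtype.val '' F : Set V)) : x.1 ∈ s := by
    obtain ⟨y, -, hy⟩ := x.2
    exact hy ▸ y.2
  have hF (x : (Subtype.val '' F : Set V)) : (⟨x.1, hs x⟩ : s) ∈ F := by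
    obtain ⟨y, hyF, hy⟩ := x.2
    rwa [show (⟨x.1, hs x⟩ : s) = y from Subtype.ext hy.symm]
  refine h.comap (f := ⟨fun x => ⟨⟨x.1, hs x⟩, hF x⟩, fun hab => hab⟩) ?_
  intro a b hab
  exact Subtype.ext (congrArg (fun z => z.1.1) hab)

end SimpleGraph

open SimpleGraph

section

variable {V : Type*} {G : SimpleGraph V}

lemma TwoIndepSet.mono {S T : Set V} (h : TwoIndepSet G T) (hST : S ⊆ T) : TwoIndepSet G S :=
  fun u hu v hv => h u (hST hu) v (hST hv)

lemma TwoIndepSet.insert {S : Set V} (h : TwoIndepSet G S) {x : V}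
    (hx : ∀ a ∈ S, ¬G.Adj x a ∧ ∀ w, ¬(G.Adj x w ∧ G.Adj w a)) :
    TwoIndepSet G (insert x S) := by
  rintro u (rfl | hu) w (rfl | hw) hne
  · exact absurd rfl hne
  · exact hx w hw
  · exact ⟨fun h' => (hx u hu).1 h'.symm, fun z hz => (hx u hu).2 z ⟨hz.2.symm, hz.1.symm⟩⟩
  · exact h u hu w hw hne

/-- A 2-independent set of `G[s]` is 2-independent in `G` if every vertex outside `s` has at most
one neighbor in `s`. -/
lemma TwoIndepSet.image_val {s : Set V} {A : Set s} (h : TwoIndepSet (G.induce s) A)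
    (hs : ∀ z ∉ s, ∀ a ∈ s, ∀ b ∈ s, G.Adj z a → G.Adj z b → a = b) :
    TwoIndepSet G (Subtype.val '' A) := by
  rintro _ ⟨a, ha, rfl⟩ _ ⟨b, hb, rfl⟩ hne
  obtain ⟨hadj, hcommon⟩ := h a ha b hb fun e => hne (congrArg _ e)
  refine ⟨hadj, fun z hz => ?_⟩
  by_cases hzs : z ∈ s
  · exact hcommon ⟨z, hzs⟩ hz
  · exact hne (hs z hzs a a.2 b b.2 hz.1.symm hz.2)

/-- `F ⊔ A ⊔ B` is a partition of the vertex set `s` into an induced forest of `G` and two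
2-independent sets of `G`. -/
structure IsFIIPartitionOn (G : SimpleGraph V) (s F A B : Set V) : Prop where
  mem_iff : ∀ x, x ∈ s ↔ x ∈ F ∨ x ∈ A ∨ x ∈ B
  disjoint_FA : ∀ x ∈ F, x ∉ A
  disjoint_FB : ∀ x ∈ F, x ∉ B
  disjoint_AB : ∀ x ∈ A, x ∉ B
  acyclic : (G.induce F).IsAcyclic
  twoIndep_A : TwoIndepSet G A
  twoIndep_B : TwoIndepSet G B

namespace IsFIIPartitionOn

variable {s F A B : Set V}

lemma swap (h : IsFIIPartitionOn G s F A B) : IsFIIPartitionOn G s F B A where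
  mem_iff x := by rw [h.mem_iff x, or_comm (a := x ∈ A)]
  disjoint_FA := h.disjoint_FB
  disjoint_FB := h.disjoint_FA
  disjoint_AB x hB hA := h.disjoint_AB x hA hB
  acyclic := h.acyclic
  twoIndep_A := h.twoIndep_B
  twoIndep_B := h.twoIndep_A

lemma hasFIIPartition (h : IsFIIPartitionOn G Set.univ F A B) : HasFIIPartition G :=
  ⟨F, A, B, fun x => (h.mem_iff x).1 trivial, Set.disjoint_left.2 h.disjoint_FA,
    Set.disjoint_left.2 h.disjoint_FB, Set.disjoint_left.2 h.disjoint_AB, h.acyclic,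
    h.twoIndep_A, h.twoIndep_B⟩

lemma insert_forest (h : IsFIIPartitionOn G s F A B) {x : V} (hxs : x ∉ s)
    (hx : ∀ a ∈ F, ∀ b ∈ F, G.Adj x a → G.Adj x b → a = b) :
    IsFIIPartitionOn G (insert x s) (insert x F) A B where
  mem_iff y := by simp only [Set.mem_insert_iff, h.mem_iff y, or_assoc]
  disjoint_FA := by
    rintro y (rfl | hy) hA
    · exact hxs ((h.mem_iff _).2 (.inr (.inl hA)))
    · exact h.disjoint_FA y hy hA
  disjoint_FB := by
    rintro y (rfl | hy) hB
    · exact hxs ((h.mem_iff _).2 (.inr (.inr hB)))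
    · exact h.disjoint_FB y hy hB
  disjoint_AB := h.disjoint_AB
  acyclic := h.acyclic.induce_insert hx
  twoIndep_A := h.twoIndep_A
  twoIndep_B := h.twoIndep_B

lemma insert_left (h : IsFIIPartitionOn G s F A B) {x : V} (hxs : x ∉ s)
    (hx : ∀ a ∈ A, ¬G.Adj x a ∧ ∀ w, ¬(G.Adj x w ∧ G.Adj w a)) :
    IsFIIPartitionOn G (insert x s) F (insert x A) B where
  mem_iff y := by simp only [Set.mem_insert_iff, h.mem_iff y, or_assoc, or_left_comm]
  disjoint_FA := by
    rintro y hy (rfl | hA)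
    · exact hxs ((h.mem_iff _).2 (.inl hy))
    · exact h.disjoint_FA y hy hA
  disjoint_FB := h.disjoint_FB
  disjoint_AB := by
    rintro y (rfl | hy) hB
    · exact hxs ((h.mem_iff _).2 (.inr (.inr hB)))
    · exact h.disjoint_AB y hy hB
  acyclic := h.acyclic
  twoIndep_A := h.twoIndep_A.insert hx
  twoIndep_B := h.twoIndep_B

/-- A vertex of `A` may be moved to `F` if `F` remains an induced forest. -/
lemma move_left (h : IsFIIPartitionOn G s F A B) {x : V} (hx : x ∈ A)
    (hF : (G.induce (insert x F)).IsAcyclic) :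
    IsFIIPartitionOn G s (insert x F) (A \ {x}) B where
  mem_iff y := by
    rw [h.mem_iff y]
    by_cases hy : y = x <;> simp [hy, hx]
  disjoint_FA := by
    rintro y (rfl | hy) hA
    · exact hA.2 rfl
    · exact h.disjoint_FA y hy hA.1
  disjoint_FB := by
    rintro y (rfl | hy)
    · exact h.disjoint_AB _ hx
    · exact h.disjoint_FB y hy
  disjoint_AB y hy := h.disjoint_AB y hy.1
  acyclic := hF
  twoIndep_A := h.twoIndep_A.mono Set.sdiff_subset
  twoIndep_B := h.twoIndep_B

/-- If the apex of a pendent triangle avoids the forest part, the partition extends to the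
triangle. -/
lemma extend_of_apex_notMem {v t1 t2 : V} (h12 : t1 ≠ t2)
    (ht1 : ∀ w, G.Adj t1 w → w = v ∨ w = t2) (ht2 : ∀ w, G.Adj t2 w → w = v ∨ w = t1)
    (h : IsFIIPartitionOn G ({t1, t2} : Set V)ᶜ F A B) (hv : v ∉ F) : HasFIIPartition G := by
  have hF (a : V) (ha : a ∈ F) : a ≠ t1 ∧ a ≠ t2 := by simpa using (h.mem_iff a).2 (.inl ha)
  have key := (h.insert_forest (x := t1) (by simp) fun a ha _ _ hta _ => by
    rcases ht1 a hta with rfl | rfl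
    exacts [absurd ha hv, absurd rfl (hF _ ha).2]).insert_forest (x := t2) (by simp [h12.symm]) (by
      have hn (a : V) (ha : a ∈ insert t1 F) (hta : G.Adj t2 a) : a = t1 := by
        rcases ht2 a hta with rfl | rfl
        exacts [ha.resolve_right hv, rfl]
      exact fun a ha b hb hta htb => (hn a ha hta).trans (hn b hb htb).symm)
  rw [show insert t2 (insert t1 ({t1, t2} : Set V)ᶜ) = Set.univ by ext; simp; tauto] at key
  exact key.hasFIIPartition

/-- If the apex of a pendent triangle is in the forest part and has no neighbor in one of the
2-independent parts, the partition extends to the triangle. -/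
lemma extend_of_apex_mem {v t1 t2 : V} (h12 : t1 ≠ t2)
    (ht1 : ∀ w, G.Adj t1 w → w = v ∨ w = t2) (ht2 : ∀ w, G.Adj t2 w → w = v ∨ w = t1)
    (h : IsFIIPartitionOn G ({t1, t2} : Set V)ᶜ F A B) (hv : v ∈ F)
    (hA : ∀ a ∈ A, ¬G.Adj v a) : HasFIIPartition G := by
  have hF (a : V) (ha : a ∈ F) : a ≠ t1 ∧ a ≠ t2 := by simpa using (h.mem_iff a).2 (.inl ha)
  have hAt (a : V) (ha : a ∈ A) : a ≠ t1 ∧ a ≠ t2 := by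
    simpa using (h.mem_iff a).2 (.inr (.inl ha))
  have key := (h.insert_left (x := t1) (by simp) fun a ha => ⟨fun hta => by
    rcases ht1 a hta with rfl | rfl
    exacts [h.disjoint_FA _ hv ha, (hAt _ ha).2 rfl], fun w hw => by
    rcases ht1 w hw.1 with rfl | rfl
    · exact hA a ha hw.2
    · rcases ht2 a hw.2 with rfl | rfl
      exacts [h.disjoint_FA _ hv ha, (hAt _ ha).1 rfl]⟩).insert_forest (x := t2)
      (by simp [h12.symm]) (by
      have hn (a : V) (ha : a ∈ F) (hta : G.Adj t2 a) : a = v :=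
        (ht2 a hta).resolve_right (hF a ha).1
      exact fun a ha b hb hta htb => (hn a ha hta).trans (hn b hb htb).symm)
  rw [show insert t2 (insert t1 ({t1, t2} : Set V)ᶜ) = Set.univ by ext; simp; tauto] at key
  exact key.hasFIIPartition

/-- If the apex `v` of a pendent triangle is in the forest part, its other neighbors are `v1` in one
2-independent part and `v2` in the other, and `v1` has at most one neighbor besides `v`, then the
partition extends to the triangle after moving `v1` to the forest part. -/
lemma extend_of_separated {v t1 t2 v1 v2 u : V} (h12 : t1 ≠ t2)
    (ht1 : ∀ w, G.Adj t1 w → w = v ∨ w = t2) (ht2 : ∀ w, G.Adj t2 w → w = v ∨ w = t1)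
    (hv : ∀ w, G.Adj v w → w = t1 ∨ w = t2 ∨ w = v1 ∨ w = v2)
    (hv1 : ∀ w, G.Adj v1 w → w = v ∨ w = u)
    (h : IsFIIPartitionOn G ({t1, t2} : Set V)ᶜ F A B) (hvF : v ∈ F)
    (hv1A : v1 ∈ A) (hv2B : v2 ∈ B) : HasFIIPartition G := by
  have hs (x : V) (hx : x ∈ F ∨ x ∈ A ∨ x ∈ B) : x ≠ t1 ∧ x ≠ t2 := by
    simpa using (h.mem_iff x).2 hx
  have hnv (a : V) (ha : a ∈ insert v1 (F \ {v})) (hva : G.Adj v a) : a = v1 := by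
    refine ha.resolve_right fun haF => ?_
    rcases hv a hva with rfl | rfl | rfl | rfl
    exacts [(hs _ (.inl haF.1)).1 rfl, (hs _ (.inl haF.1)).2 rfl, h.disjoint_FA _ haF.1 hv1A,
      h.disjoint_FB _ haF.1 hv2B]
  have hnv1 (a : V) (ha : a ∈ F \ {v}) (hva : G.Adj v1 a) : a = u :=
    (hv1 a hva).resolve_left ha.2
  have hacyc : (G.induce (insert v (insert v1 (F \ {v})))).IsAcyclic :=
    ((h.acyclic.induce_mono Set.sdiff_subset).induce_insert fun a ha b hb hva hvb =>
      (hnv1 a ha hva).trans (hnv1 b hb hvb).symm).induce_insert fun a ha b hb hva hvb =>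
        (hnv a ha hva).trans (hnv b hb hvb).symm
  rw [Set.insert_comm, Set.insert_sdiff_singleton, Set.insert_eq_of_mem hvF] at hacyc
  refine (h.move_left hv1A hacyc).extend_of_apex_mem h12 ht1 ht2 (.inr hvF) ?_
  rintro a ⟨ha, hne⟩ hva
  rcases hv a hva with rfl | rfl | rfl | rfl
  exacts [(hs _ (.inr (.inl ha))).1 rfl, (hs _ (.inr (.inl ha))).2 rfl, hne rfl,
    h.disjoint_AB _ ha hv2B]

end IsFIIPartitionOn

lemma IsFIIPartition.image_val {s : Set V} {F A B : Set s}
    (h : IsFIIPartition (G.induce s) F A B)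
    (hs : ∀ z ∉ s, ∀ a ∈ s, ∀ b ∈ s, G.Adj z a → G.Adj z b → a = b) :
    IsFIIPartitionOn G s (Subtype.val '' F) (Subtype.val '' A) (Subtype.val '' B) := by
  obtain ⟨hcov, hFA, hFB, hAB, hac, hA, hB⟩ := h
  have hdisj {S T : Set s} (hST : Disjoint S T) :
      ∀ x ∈ Subtype.val '' S, x ∉ Subtype.val '' T :=
    Set.disjoint_left.1 (Set.disjoint_image_of_injective Subtype.val_injective hST)
  refine ⟨fun x => ⟨fun hx => ?_, ?_⟩, hdisj hFA, hdisj hFB, hdisj hAB, hac.induce_image_val,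
    hA.image_val hs, hB.image_val hs⟩
  · exact (hcov ⟨x, hx⟩).imp (fun hF => ⟨_, hF, rfl⟩)
      (Or.imp (fun hA => ⟨_, hA, rfl⟩) fun hB => ⟨_, hB, rfl⟩)
  · rintro (⟨y, -, rfl⟩ | ⟨y, -, rfl⟩ | ⟨y, -, rfl⟩) <;> exact y.2

end

/-- [C8] (case `v1 ∈ W₂`) If `v` is a 4-vertex on one pendent triangle `v t1 t2` whose
further neighbor `v1` is a 2-vertex not on a pendent triangle (its two neighbors are
non-adjacent), and `G − {t1, t2}` has an FII-partition, then so does `G`. -/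
theorem hasFIIPartition_of_W4_with_W2_neighbor {V : Type*} [Fintype V]
    (G : SimpleGraph V) (v t1 t2 v1 v2 : V)
    (hne : List.Pairwise (· ≠ ·) [v, t1, t2, v1, v2])
    (ht1 : G.Adj v t1) (ht2 : G.Adj v t2) (h12 : G.Adj t1 t2)
    (hv1 : G.Adj v v1) (hv2 : G.Adj v v2)
    (hdv : G.degree v = 4)
    (hdt1 : G.degree t1 = 2) (hdt2 : G.degree t2 = 2)
    (hdv1 : G.degree v1 = 2)
    (hv1nt : ∀ a b, G.Adj v1 a → G.Adj v1 b → ¬G.Adj a b)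
    (h : HasFIIPartition (G.induce ({t1, t2} : Set V)ᶜ)) :
    HasFIIPartition G := by
  simp only [List.pairwise_cons, List.mem_cons, List.not_mem_nil, or_false, forall_eq_or_imp,
    forall_eq] at hne
  obtain ⟨⟨hvt1, hvt2, hvv1, hvv2⟩, ⟨htt, ht1v1, ht1v2⟩, ⟨ht2v1, ht2v2⟩, hvv, -⟩ := hne
  have nt1 (w : V) : G.Adj t1 w → w = v ∨ w = t2 := by
    simpa using (adj_iff_mem_of_card_eq_degree (s := {v, t2}) (by simp [ht1.symm, h12])
      (by rw [hdt1, Finset.card_pair hvt2]) w).1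
  have nt2 (w : V) : G.Adj t2 w → w = v ∨ w = t1 := by
    simpa using (adj_iff_mem_of_card_eq_degree (s := {v, t1}) (by simp [ht2.symm, h12.symm])
      (by rw [hdt2, Finset.card_pair hvt1]) w).1
  have nv (w : V) : G.Adj v w → w = t1 ∨ w = t2 ∨ w = v1 ∨ w = v2 := by
    simpa using (adj_iff_mem_of_card_eq_degree (s := {t1, t2, v1, v2})
      (by simp [ht1, ht2, hv1, hv2])
      (by simp [hdv, Finset.card_insert_of_notMem, htt, ht1v1, ht1v2, ht2v1, ht2v2, hvv]) w).1
  obtain ⟨u, nv1⟩ : ∃ u, ∀ w, G.Adj v1 w → w = v ∨ w = u := by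
    obtain ⟨a, b, -, hab⟩ := Finset.card_eq_two.1 hdv1
    have hmem (w : V) : G.Adj v1 w ↔ w = a ∨ w = b := by
      rw [← mem_neighborFinset, hab]
      simp
    rcases (hmem v).1 hv1.symm with rfl | rfl
    exacts [⟨b, fun w => (hmem w).1⟩, ⟨a, fun w hw => ((hmem w).1 hw).symm⟩]
  obtain ⟨F, A, B, hpart⟩ := h
  have h := hpart.image_val fun z hz a ha b hb hza hzb => by
    simp only [Set.mem_compl_iff, Set.mem_insert_iff, Set.mem_singleton_iff, not_or] at hz ha hb
    grind
  generalize Subtype.val '' F = F at h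
  generalize Subtype.val '' A = A at h
  generalize Subtype.val '' B = B at h
  by_cases hvF : v ∈ F
  swap
  · exact h.extend_of_apex_notMem htt nt1 nt2 hvF
  by_cases hA : ∀ a ∈ A, ¬G.Adj v a
  · exact h.extend_of_apex_mem htt nt1 nt2 hvF hA
  by_cases hB : ∀ b ∈ B, ¬G.Adj v b
  · exact h.swap.extend_of_apex_mem htt nt1 nt2 hvF hB
  push Not at hA hB
  obtain ⟨a, ha, hva⟩ := hA
  obtain ⟨b, hb, hvb⟩ := hB
  have hs (x : V) (hx : x ∈ F ∨ x ∈ A ∨ x ∈ B) : x ≠ t1 ∧ x ≠ t2 := by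
    simpa using (h.mem_iff x).2 hx
  have hab : a ≠ b := fun e => h.disjoint_AB a ha (e ▸ hb)
  have hsa := hs a (.inr (.inl ha))
  have hsb := hs b (.inr (.inr hb))
  obtain ⟨rfl, rfl⟩ | ⟨rfl, rfl⟩ : (a = v1 ∧ b = v2) ∨ (b = v1 ∧ a = v2) := by grind
  · exact h.extend_of_separated htt nt1 nt2 nv nv1 hvF ha hb
  · exact h.swap.extend_of_separated htt nt1 nt2 nv nv1 hvF hb ha
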